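/- Let S be a type, R : S → S → Prop a binary relation, and A, B ⊆ S. Consider the monotone operator G on the complete lattice of functions S → [0,1] (ordered pointwise) defined by G(f)(s) = max(χ_B(s), min(χ_A(s), e_f(s))), where e_f(s) = 1 if s has at least one R-successor and f(t) = 1 for every t with R s t, and e_f(s) = 0 otherwise. Then the least fixed point of G is the indicator function of the set of states s such that every maximal R-path starting at s (i.e. every finite path ending in a state with no R-successor, and every infinite path) has an initial segment s = s₀, …, sₙ with sₙ ∈ B and sᵢ ∈ A for all i < n. (This is the correctness of the encoding E(∀(φ₁ U φ₂)) = μX.(E(φ₂) ⊔ (E(φ₁) ⊓ P_{=1}(□X ⊓ ◇1))) in the case where φ₁, φ₂ denote the {0,1}-valued indicators of A and B.) -/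

import Mathlib

open unitInterval

instance : Fact ((0:ℝ) ≤ 1) := ⟨zero_le_one⟩

/-- The states from which `A` until `B` inevitably holds along `R`: the least set containing `B`
and every non-terminal state of `A` all of whose successors it contains. -/
inductive Inevitable {S : Type*} (R : S → S → Prop) (A B : Set S) : S → Prop
  | base {s : S} (hs : s ∈ B) : Inevitable R A B s
  | step {s : S} (hs : s ∈ A) (hex : ∃ t, R s t) (hall : ∀ t, R s t → Inevitable R A B t) :
      Inevitable R A B s

namespace Inevitable

variable {S : Type*} {R : S → S → Prop} {A B : Set S}

theorem exists_of_infinite_path {s : S} (h : Inevitable R A B s) :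
    ∀ p : ℕ → S, p 0 = s → (∀ i, R (p i) (p (i + 1))) → ∃ n, p n ∈ B ∧ ∀ i < n, p i ∈ A := by
  induction h with
  | base hs =>
    rintro p rfl -
    exact ⟨0, hs, by simp⟩
  | step hs _ _ ih =>
    rintro p rfl hp
    obtain ⟨n, hn, hA⟩ := ih (p 1) (hp 0) (fun i => p (i + 1)) rfl (fun i => hp (i + 1))
    refine ⟨n + 1, hn, fun i hi => ?_⟩
    cases i with
    | zero => exact hs
    | succ i => exact hA i (by omega)

theorem exists_of_finite_path {s : S} (h : Inevitable R A B s) :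
    ∀ (n : ℕ) (p : ℕ → S), p 0 = s → (∀ i < n, R (p i) (p (i + 1))) →
      (¬ ∃ t, R (p n) t) → ∃ m ≤ n, p m ∈ B ∧ ∀ i < m, p i ∈ A := by
  induction h with
  | base hs =>
    rintro n p rfl - -
    exact ⟨0, n.zero_le, hs, by simp⟩
  | step hs hex _ ih =>
    rintro n p rfl hp hn
    cases n with
    | zero => exact absurd hex hn
    | succ n =>
      obtain ⟨m, hmn, hm, hA⟩ := ih (p 1) (hp 0 n.succ_pos) n (fun i => p (i + 1)) rfl
        (fun i hi => hp (i + 1) (by omega)) hn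
      refine ⟨m + 1, by omega, hm, fun i hi => ?_⟩
      cases i with
      | zero => exact hs
      | succ i => exact hA i (by omega)

theorem of_forall_path {s : S}
    (hinf : ∀ p : ℕ → S, p 0 = s → (∀ i, R (p i) (p (i + 1))) →
      ∃ n, p n ∈ B ∧ ∀ i < n, p i ∈ A)
    (hfin : ∀ (n : ℕ) (p : ℕ → S), p 0 = s → (∀ i < n, R (p i) (p (i + 1))) →
      (¬ ∃ t, R (p n) t) → ∃ m ≤ n, p m ∈ B ∧ ∀ i < m, p i ∈ A) :
    Inevitable R A B s := by
  classical
  by_contra hs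
  have hnext : ∀ u : S, ∃ v, ((∃ t, R u t) → R u v) ∧
      ((∃ t, R u t ∧ ¬ Inevitable R A B t) → ¬ Inevitable R A B v) := by
    intro u
    by_cases h : ∃ t, R u t ∧ ¬ Inevitable R A B t
    · obtain ⟨t, ht, ht'⟩ := h
      exact ⟨t, fun _ => ht, fun _ => ht'⟩
    · by_cases h' : ∃ t, R u t
      · obtain ⟨t, ht⟩ := h'
        exact ⟨t, fun _ => ht, fun h'' => absurd h'' h⟩
      · exact ⟨u, fun h'' => absurd h'' h', fun h'' => absurd h'' h⟩
  choose next hR hI using hnext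
  let p : ℕ → S := fun n => Nat.rec s (fun _ u => next u) n
  have avoid : ∀ m, (∀ i < m, p i ∈ A) → (∀ i < m, R (p i) (p (i + 1))) →
      ¬ Inevitable R A B (p m) := by
    intro m
    induction m with
    | zero => exact fun _ _ => hs
    | succ m ih =>
      intro hA hp
      have hm := ih (fun i hi => hA i (by omega)) (fun i hi => hp i (by omega))
      refine hI (p m) ?_
      by_contra! hcon
      exact hm (.step (hA m (by omega)) ⟨_, hp m (by omega)⟩ hcon)
  by_cases hp : ∀ i, R (p i) (p (i + 1))
  · obtain ⟨n, hn, hA⟩ := hinf p rfl hp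
    exact avoid n hA (fun i _ => hp i) (.base hn)
  · push Not at hp
    have hlt : ∀ i < Nat.find hp, R (p i) (p (i + 1)) :=
      fun i hi => not_not.mp (Nat.find_min hp hi)
    obtain ⟨m, hmn, hm, hA⟩ := hfin (Nat.find hp) p rfl hlt
      (fun h => Nat.find_spec hp (hR _ h))
    exact avoid m hA (fun i hi => hlt i (by omega)) (.base hm)

end Inevitable

/-- Correctness of the encoding `E(∀(φ₁ U φ₂)) = μX.(E(φ₂) ⊔ (E(φ₁) ⊓ P_{=1}(□X ⊓ ◇1)))`
for `{0,1}`-valued `φ₁, φ₂` denoting sets `A, B`: the least fixed point of the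
operator `G(f)(s) = max(χ_B s, min(χ_A s, e_f s))`, where `e_f` is the indicator
of `{s | (∃ t, R s t) ∧ ∀ t, R s t → f t = 1}`, is the indicator of the set of
states all of whose maximal `R`-paths (finite maximal or infinite) have an
initial segment `s = s₀, …, sₙ` with `sₙ ∈ B` and `sᵢ ∈ A` for all `i < n`. -/
theorem stmt10 {S : Type*} (R : S → S → Prop) (A B : Set S)
    (G : (S → I) →o (S → I))
    (hG : ∀ (f : S → I) (s : S),
      G f s = max (B.indicator (fun _ => (1 : I)) s)
        (min (A.indicator (fun _ => (1 : I)) s)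
          ({s' : S | (∃ t, R s' t) ∧ ∀ t, R s' t → f t = 1}.indicator
            (fun _ => (1 : I)) s))) :
    OrderHom.lfp G =
      ({s : S |
          (∀ p : ℕ → S, p 0 = s → (∀ i, R (p i) (p (i + 1))) →
            ∃ n, p n ∈ B ∧ ∀ i < n, p i ∈ A) ∧
          (∀ (n : ℕ) (p : ℕ → S), p 0 = s → (∀ i < n, R (p i) (p (i + 1))) →
            (¬ ∃ t, R (p n) t) →
            ∃ m ≤ n, p m ∈ B ∧ ∀ i < m, p i ∈ A)}).indicator
        (fun _ => (1 : I)) := by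
  have hset : {s : S |
      (∀ p : ℕ → S, p 0 = s → (∀ i, R (p i) (p (i + 1))) →
        ∃ n, p n ∈ B ∧ ∀ i < n, p i ∈ A) ∧
      (∀ (n : ℕ) (p : ℕ → S), p 0 = s → (∀ i < n, R (p i) (p (i + 1))) →
        (¬ ∃ t, R (p n) t) →
        ∃ m ≤ n, p m ∈ B ∧ ∀ i < m, p i ∈ A)} = {s | Inevitable R A B s} := by
    ext s
    exact ⟨fun h => .of_forall_path h.1 h.2,
      fun h => ⟨h.exists_of_infinite_path, h.exists_of_finite_path⟩⟩
  rw [hset]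
  apply le_antisymm
  · refine OrderHom.lfp_le G fun s => ?_
    by_cases hs : Inevitable R A B s
    · rw [Set.indicator_of_mem (show s ∈ {s | Inevitable R A B s} from hs)]
      exact unitInterval.le_one'
    · have hB : s ∉ B := fun h => hs (.base h)
      rw [hG, Set.indicator_of_notMem hB]
      by_cases hA : s ∈ A
      · rw [Set.indicator_of_notMem (s := {s' : S | _ ∧ _})]
        · simp
        · rintro ⟨hex, hall⟩
          refine hs (.step hA hex fun t ht => ?_)
          by_contra hcon
          have h1 := hall t ht
          rw [Set.indicator_of_notMem (show t ∉ {s | Inevitable R A B s} from hcon)] at h1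
          exact zero_ne_one h1
      · simp [Set.indicator_of_notMem hA]
  · intro s
    by_cases hs : Inevitable R A B s
    · suffices h : OrderHom.lfp G s = 1 by
        rw [h]
        exact Set.indicator_le_self' (fun _ _ => zero_le_one) s
      induction hs with
      | base hs =>
        rw [← OrderHom.map_lfp, hG, Set.indicator_of_mem hs]
        exact max_eq_left unitInterval.le_one'
      | @step s hs hex _ ih =>
        rw [← OrderHom.map_lfp, hG, Set.indicator_of_mem hs,
          Set.indicator_of_mem (show s ∈ {s' : S | (∃ t, R s' t) ∧
            ∀ t, R s' t → OrderHom.lfp G t = 1} from ⟨hex, ih⟩), min_self]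
        exact max_eq_right unitInterval.le_one'
    · rw [Set.indicator_of_notMem (show s ∉ {s | Inevitable R A B s} from hs)]
      exact unitInterval.nonneg'
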